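/- arXiv:0904.2557 — 2 statements merged into one kernel-verified Lean document; each statement's English description precedes it below -/
import Mathlib

section
/- Quantum Singleton bound (Knill–Laflamme bound): Let C be an [[n,k,d]] quantum code with k ≥ 1 and d ≥ 1. Then n − k ≥ 2d − 2. -/
open Matrix Finset

noncomputable section

/-- The space of `2^n × 2^n` complex matrices, realized as matrices indexed by
`n`-bit strings (the `n`-fold Kronecker product of `M₂(ℂ)`). -/
abbrev MatN (n : ℕ) := Matrix (Fin n → Fin 2) (Fin n → Fin 2) ℂ

/-- The Pauli matrix `X`. -/
def PX : Matrix (Fin 2) (Fin 2) ℂ := !![0, 1; 1, 0]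

/-- The Pauli matrix `Y`. -/
def PY : Matrix (Fin 2) (Fin 2) ℂ := !![0, -Complex.I; Complex.I, 0]

/-- The Pauli matrix `Z`. -/
def PZ : Matrix (Fin 2) (Fin 2) ℂ := !![1, 0; 0, -1]

/-- A single-qubit Pauli matrix: one of `1, X, Y, Z`. -/
def IsSinglePauli (σ : Matrix (Fin 2) (Fin 2) ℂ) : Prop :=
  σ = 1 ∨ σ = PX ∨ σ = PY ∨ σ = PZ

/-- The Kronecker (tensor) product `σ₁ ⊗ ⋯ ⊗ σₙ` of single-qubit matrices, with entries
`(⊗ⱼ σⱼ) x y = ∏ⱼ (σⱼ) (x j) (y j)`. -/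
def tensorPauli {n : ℕ} (σ : Fin n → Matrix (Fin 2) (Fin 2) ℂ) : MatN n :=
  Matrix.of fun x y => ∏ j, σ j (x j) (y j)

/-- An `n`-qubit Pauli operator: `i^c • σ₁ ⊗ ⋯ ⊗ σₙ` with `c ∈ {0,1,2,3}` and each
`σⱼ ∈ {1, X, Y, Z}`. -/
def IsPauli (n : ℕ) (P : MatN n) : Prop :=
  ∃ (c : ℕ) (σ : Fin n → Matrix (Fin 2) (Fin 2) ℂ),
    c < 4 ∧ (∀ j, IsSinglePauli (σ j)) ∧ P = Complex.I ^ c • tensorPauli σ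

/-- An `n`-qubit Pauli operator of weight at most `w`: at most `w` of the tensor factors
are different from the identity. -/
def IsPauliOfWeightLE (n w : ℕ) (P : MatN n) : Prop :=
  ∃ (c : ℕ) (σ : Fin n → Matrix (Fin 2) (Fin 2) ℂ),
    c < 4 ∧ (∀ j, IsSinglePauli (σ j)) ∧ Nat.card {j // σ j ≠ 1} ≤ w ∧
      P = Complex.I ^ c • tensorPauli σ

/-- The weight of an `n`-qubit Pauli operator: the number of tensor factors which are not
the identity (defined as an infimum over representations). -/
def pauliWeight {n : ℕ} (P : MatN n) : ℕ :=
  sInf {w | ∃ (c : ℕ) (σ : Fin n → Matrix (Fin 2) (Fin 2) ℂ),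
    c < 4 ∧ (∀ j, IsSinglePauli (σ j)) ∧ Nat.card {j // σ j ≠ 1} = w ∧
      P = Complex.I ^ c • tensorPauli σ}

/-- The code space `T(S)` of a set `S` of matrices: the states fixed by every `M ∈ S`. -/
def codeSpace {n : ℕ} (S : Set (MatN n)) : Submodule ℂ ((Fin n → Fin 2) → ℂ) where
  carrier := {ψ | ∀ M ∈ S, M.mulVec ψ = ψ}
  add_mem' := by
    intro ψ φ hψ hφ M hM
    rw [Matrix.mulVec_add, hψ M hM, hφ M hM]
  zero_mem' := by
    intro M hM
    rw [Matrix.mulVec_zero]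
  smul_mem' := by
    intro c ψ hψ M hM
    rw [Matrix.mulVec_smul, hψ M hM]

/-- An `[[n,k,d]]` quantum code: a subspace of `ℂ^{2^n}` of dimension `2^k` such that no
`n`-qubit Pauli operator of weight at most `d−1` can distinguish codewords, i.e.
`⟪ψ, E ψ⟫` is constant over unit vectors `ψ` in the code. -/
def IsQuantumCode (n k d : ℕ) (C : Submodule ℂ ((Fin n → Fin 2) → ℂ)) : Prop :=
  Module.finrank ℂ C = 2 ^ k ∧
  ∀ E : MatN n, IsPauliOfWeightLE n (d - 1) E →
    ∃ cE : ℂ, ∀ ψ ∈ C, star ψ ⬝ᵥ ψ = 1 → star ψ ⬝ᵥ E.mulVec ψ = cE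

/-- Every matrix factors through a space of dimension equal to its rank. -/
lemma exists_eq_mul_of_rank {m l : Type*} [Fintype m] [Fintype l] (M : Matrix m l ℂ) :
    ∃ (U : Matrix m (Fin M.rank) ℂ) (V : Matrix (Fin M.rank) l ℂ), M = U * V := by
  classical
  let b := Module.finBasis ℂ (LinearMap.range M.mulVecLin)
  let v : l → LinearMap.range M.mulVecLin := fun j => ⟨M.mulVecLin (Pi.single j 1), _, rfl⟩
  refine ⟨Matrix.of fun x s => (b s : m → ℂ) x, Matrix.of fun s j => b.repr (v j) s, ?_⟩
  ext x j
  have h := congrFun (congrArg Subtype.val (b.sum_repr (v j))) x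
  simp only [AddSubmonoidClass.coe_finsetSum, Submodule.coe_smul, Finset.sum_apply,
    Pi.smul_apply, smul_eq_mul, v, mulVecLin_apply, mulVec_single_one, col_apply] at h
  rw [← h, Matrix.mul_apply]
  simp only [Matrix.of_apply, v, mulVecLin_apply, mulVec_single_one]
  exact Finset.sum_congr rfl fun s _ => mul_comm _ _

open scoped Kronecker in
lemma card_mul_rank_le_rank_one_kronecker {ι m : Type*} [Fintype ι] [DecidableEq ι] [Fintype m]
    (P : Matrix m m ℂ) :
    Fintype.card ι * P.rank ≤ ((1 : Matrix ι ι ℂ) ⊗ₖ P).rank := by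
  let f : (ι → LinearMap.range P.mulVecLin) →ₗ[ℂ]
      LinearMap.range ((1 : Matrix ι ι ℂ) ⊗ₖ P).mulVecLin :=
    { toFun := fun g => ⟨fun p => (g p.1 : m → ℂ) p.2, by
        choose w hw using fun i => (g i).2
        refine ⟨fun p => w p.1 p.2, ?_⟩
        ext ⟨i, x⟩
        rw [← hw]
        simp [Matrix.mulVec, dotProduct, Fintype.sum_prod_type, Matrix.one_apply, ite_mul]⟩
      map_add' := fun _ _ => rfl
      map_smul' := fun _ _ => rfl }
  have hf : Function.Injective f := by
    intro g h hgh
    ext i x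
    exact congrFun (congrArg Subtype.val hgh) (i, x)
  simpa [Matrix.rank, Module.finrank_pi_fintype] using
    LinearMap.finrank_le_finrank_of_injective hf

section TripartiteStates

variable {ι a b c : Type*} [Fintype ι] [DecidableEq ι] [Fintype a] [Fintype b] [Fintype c]

open scoped Kronecker ComplexOrder in
lemma card_mul_rank_le_rank_mul_card (ψ : ι → a → b → c → ℂ) {P : Matrix a a ℂ}
    {Q : Matrix b b ℂ}
    (hP : ∀ i j x x', ∑ y, ∑ z, ψ i x y z * star (ψ j x' y z) = if i = j then P x x' else 0)
    (hQ : ∀ i j y y', ∑ x, ∑ z, ψ i x y z * star (ψ j x y' z) = if i = j then Q y y' else 0) :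
    Fintype.card ι * P.rank ≤ Q.rank * Fintype.card c := by
  classical
  let M : Matrix (ι × a) (b × c) ℂ := Matrix.of fun p q => ψ p.1 p.2 q.1 q.2
  let N : Matrix b (ι × a × c) ℂ := Matrix.of fun y p => ψ p.1 p.2.1 y p.2.2
  have hM : M * Mᴴ = (1 : Matrix ι ι ℂ) ⊗ₖ P := by
    ext ⟨i, x⟩ ⟨j, x'⟩
    simpa [M, Matrix.mul_apply, Fintype.sum_prod_type, Matrix.one_apply, ite_mul] using hP i j x x'
  have hN : N * Nᴴ = ((Fintype.card ι : ℂ) • (1 : Matrix b b ℂ)) * Q := by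
    rw [Matrix.smul_mul, Matrix.one_mul]
    ext y y'
    have h : ∀ i, ∑ x, ∑ z, ψ i x y z * star (ψ i x y' z) = Q y y' := fun i => by
      simpa using hQ i i y y'
    simp only [Matrix.mul_apply, Fintype.sum_prod_type, N, conjTranspose_apply, Matrix.of_apply, h]
    simp
  have hNQ : N.rank ≤ Q.rank := by
    rw [← rank_self_mul_conjTranspose, hN]
    exact rank_mul_le_right _ _
  obtain ⟨U, V, hUV⟩ := exists_eq_mul_of_rank N
  have hfac : Mᵀ = (U ⊗ₖ (1 : Matrix c c ℂ)) *
      Matrix.of fun (p : Fin N.rank × c) (q : ι × a) => V p.1 (q.1, q.2, p.2) := by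
    ext ⟨y, z⟩ ⟨i, x⟩
    have h := congrFun (congrFun hUV y) (i, x, z)
    rw [Matrix.mul_apply] at h
    simpa [M, N, Matrix.mul_apply, Fintype.sum_prod_type, Matrix.one_apply] using h
  calc Fintype.card ι * P.rank ≤ M.rank := by
        rw [← rank_self_mul_conjTranspose M, hM]
        exact card_mul_rank_le_rank_one_kronecker P
    _ = Mᵀ.rank := (rank_transpose M).symm
    _ ≤ Fintype.card (Fin N.rank × c) := by
        rw [hfac]
        exact (rank_mul_le_left _ _).trans (rank_le_card_width _)
    _ ≤ Q.rank * Fintype.card c := by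
        rw [Fintype.card_prod, Fintype.card_fin]
        gcongr

/-- A family of tripartite states that can be distinguished neither on the first nor on the
second party is no larger than the dimension of the third. -/
lemma card_le_card_of_reduced_states (ψ : ι → a → b → c → ℂ) {P : Matrix a a ℂ}
    {Q : Matrix b b ℂ} (hP0 : P ≠ 0)
    (hP : ∀ i j x x', ∑ y, ∑ z, ψ i x y z * star (ψ j x' y z) = if i = j then P x x' else 0)
    (hQ : ∀ i j y y', ∑ x, ∑ z, ψ i x y z * star (ψ j x y' z) = if i = j then Q y y' else 0) :
    Fintype.card ι ≤ Fintype.card c := by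
  classical
  have h₁ := card_mul_rank_le_rank_mul_card ψ hP hQ
  have h₂ := card_mul_rank_le_rank_mul_card (fun i y x z => ψ i x y z) hQ hP
  have hpos : 0 < P.rank := by
    refine Nat.pos_of_ne_zero fun h => hP0 ?_
    have h' := Submodule.finrank_eq_zero.1 h
    rw [LinearMap.range_eq_bot] at h'
    ext x y
    simpa using congrFun (LinearMap.congr_fun h' (Pi.single y 1)) x
  by_contra! hlt
  nlinarith

end TripartiteStates

/-- The operators that cannot distinguish vectors of `C`. -/
def detectable {n : ℕ} (C : Submodule ℂ ((Fin n → Fin 2) → ℂ)) : Submodule ℂ (MatN n) where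
  carrier := {E | ∃ r : ℂ, ∀ φ ∈ C, ∀ ψ ∈ C, star ψ ⬝ᵥ E.mulVec φ = r * (star ψ ⬝ᵥ φ)}
  add_mem' := by
    rintro E F ⟨r, hr⟩ ⟨s, hs⟩
    refine ⟨r + s, fun φ hφ ψ hψ => ?_⟩
    rw [add_mulVec, dotProduct_add, hr φ hφ ψ hψ, hs φ hφ ψ hψ, add_mul]
  zero_mem' := ⟨0, fun φ _ ψ _ => by simp⟩
  smul_mem' := by
    rintro t E ⟨r, hr⟩
    refine ⟨t * r, fun φ hφ ψ hψ => ?_⟩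
    rw [smul_mulVec, dotProduct_smul, hr φ hφ ψ hψ, smul_eq_mul, mul_assoc]

open scoped ComplexOrder in
/-- A matrix whose expectation value is constant on unit vectors of `C` satisfies the
Knill–Laflamme condition. -/
lemma mem_detectable_of_unit {n : ℕ} {C : Submodule ℂ ((Fin n → Fin 2) → ℂ)} {E : MatN n} {r : ℂ}
    (h : ∀ ψ ∈ C, star ψ ⬝ᵥ ψ = 1 → star ψ ⬝ᵥ E.mulVec ψ = r) : E ∈ detectable C := by
  have hdiag : ∀ ψ ∈ C, star ψ ⬝ᵥ E.mulVec ψ = r * (star ψ ⬝ᵥ ψ) := by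
    intro ψ hψ
    by_cases h0 : ψ = 0
    · simp [h0]
    obtain ⟨t, ht0, ht⟩ : ∃ t : ℝ, t ≠ 0 ∧ star ψ ⬝ᵥ ψ = (t : ℂ) ^ 2 := by
      have hpos := dotProduct_star_self_pos_iff.2 h0
      rw [Complex.pos_iff] at hpos
      refine ⟨√(star ψ ⬝ᵥ ψ).re, (Real.sqrt_pos.2 hpos.1).ne', ?_⟩
      rw [← Complex.ofReal_pow, Real.sq_sqrt hpos.1.le]
      exact Complex.ext rfl hpos.2.symm
    have htc : (t : ℂ) ≠ 0 := Complex.ofReal_ne_zero.2 ht0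
    have h1 := h ((t : ℂ)⁻¹ • ψ) (C.smul_mem _ hψ)
    simp only [star_smul, smul_dotProduct, dotProduct_smul, mulVec_smul, smul_eq_mul,
      ht, star_inv₀, Complex.star_def, Complex.conj_ofReal] at h1
    have h2 := h1 (by field_simp)
    rw [ht, ← h2]
    field_simp
  refine ⟨r, fun φ hφ ψ hψ => ?_⟩
  have hφφ := hdiag φ hφ
  have hψψ := hdiag ψ hψ
  have h1 := hdiag (φ + ψ) (C.add_mem hφ hψ)
  have h2 := hdiag (φ + Complex.I • ψ) (C.add_mem hφ (C.smul_mem _ hψ))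
  simp only [star_add, star_smul, add_dotProduct, dotProduct_add, smul_dotProduct, dotProduct_smul,
    mulVec_add, mulVec_smul, smul_eq_mul, Complex.star_def, Complex.conj_I] at h1 h2
  have hI : Complex.I * Complex.I = -1 := Complex.I_mul_I
  linear_combination (1 / 2 : ℂ) * h1 + (Complex.I / 2) * h2
    - (1 / 2 + Complex.I / 2) * hφφ - (1 / 2 + Complex.I / 2) * hψψ
    + (star ψ ⬝ᵥ E *ᵥ φ - r * (star ψ ⬝ᵥ φ) + r * (star φ ⬝ᵥ ψ) - star φ ⬝ᵥ E *ᵥ ψ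
      + Complex.I * (star ψ ⬝ᵥ E *ᵥ ψ - r * (star ψ ⬝ᵥ ψ))) / 2 * hI

section TensorPauli

variable {n : ℕ}

lemma tensorPauli_update_apply (σ : Fin n → Matrix (Fin 2) (Fin 2) ℂ) (j : Fin n)
    (M : Matrix (Fin 2) (Fin 2) ℂ) (u v : Fin n → Fin 2) :
    tensorPauli (Function.update σ j M) u v =
      M (u j) (v j) * ∏ l ∈ univ.erase j, σ l (u l) (v l) := by
  rw [tensorPauli, Matrix.of_apply, ← mul_prod_erase univ _ (mem_univ j), Function.update_self]
  congr 1
  exact prod_congr rfl fun l hl => by rw [Function.update_of_ne (ne_of_mem_erase hl)]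

lemma exists_eq_pauli_sum (M : Matrix (Fin 2) (Fin 2) ℂ) :
    ∃ p q r s : ℂ, M = p • 1 + q • PX + r • PY + s • PZ := by
  refine ⟨(M 0 0 + M 1 1) / 2, (M 0 1 + M 1 0) / 2, Complex.I * (M 0 1 - M 1 0) / 2,
    (M 0 0 - M 1 1) / 2, ?_⟩
  have hI : Complex.I * Complex.I = -1 := Complex.I_mul_I
  ext i j
  fin_cases i <;> fin_cases j <;> simp [PX, PY, PZ]
  · ring
  · linear_combination ((M 0 1 - M 1 0) / 2) * hI
  · linear_combination (-(M 0 1 - M 1 0) / 2) * hI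
  · ring

lemma tensorPauli_mem_of_pauli_mem (V : Submodule ℂ (MatN n)) (A : Finset (Fin n))
    (hV : ∀ σ : Fin n → Matrix (Fin 2) (Fin 2) ℂ, (∀ j, IsSinglePauli (σ j)) →
      (∀ j ∉ A, σ j = 1) → tensorPauli σ ∈ V)
    (σ : Fin n → Matrix (Fin 2) (Fin 2) ℂ) (hσ : ∀ j ∉ A, σ j = 1) : tensorPauli σ ∈ V := by
  suffices H : ∀ (S : Finset (Fin n)), S ⊆ A → ∀ σ : Fin n → Matrix (Fin 2) (Fin 2) ℂ,
      (∀ j ∉ S, IsSinglePauli (σ j)) → (∀ j ∉ A, σ j = 1) → tensorPauli σ ∈ V from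
    H A subset_rfl σ (fun j hj => Or.inl (hσ j hj)) hσ
  intro S
  induction S using Finset.induction_on with
  | empty => exact fun _ σ h1 h2 => hV σ (fun j => h1 j (notMem_empty j)) h2
  | insert j S hj ih =>
    intro hS σ h1 h2
    have key : ∀ M, IsSinglePauli M → tensorPauli (Function.update σ j M) ∈ V := by
      intro M hM
      refine ih ((subset_insert j S).trans hS) _ (fun l hl => ?_) (fun l hl => ?_)
      · by_cases hlj : l = j
        · subst hlj
          rwa [Function.update_self]
        · rw [Function.update_of_ne hlj]
          exact h1 l (by simp [hlj, hl])
      · rw [Function.update_of_ne (fun hlj : l = j => hl (hlj ▸ hS (mem_insert_self j S)))]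
        exact h2 l hl
    obtain ⟨p, q, r, s, hM⟩ := exists_eq_pauli_sum (σ j)
    have hsum : tensorPauli σ = p • tensorPauli (Function.update σ j 1)
        + q • tensorPauli (Function.update σ j PX) + r • tensorPauli (Function.update σ j PY)
        + s • tensorPauli (Function.update σ j PZ) := by
      conv_lhs => rw [← Function.update_eq_self j σ]
      ext u v
      simp only [Matrix.add_apply, Matrix.smul_apply, tensorPauli_update_apply, hM, smul_eq_mul]
      ring
    rw [hsum]
    exact V.add_mem (V.add_mem (V.add_mem (V.smul_mem _ (key _ (.inl rfl)))
      (V.smul_mem _ (key _ (.inr (.inl rfl))))) (V.smul_mem _ (key _ (.inr (.inr (.inl rfl))))))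
      (V.smul_mem _ (key _ (.inr (.inr (.inr rfl)))))

end TensorPauli

/-- Bit strings indexed by `Fin n` as pairs of bit strings, along a bipartition of `Fin n`. -/
def glue {n : ℕ} {α β : Type*} (e : Fin n ≃ α ⊕ β) :
    (α → Fin 2) × (β → Fin 2) ≃ (Fin n → Fin 2) :=
  (Equiv.sumArrowEquivProdArrow α β (Fin 2)).symm.trans (e.symm.arrowCongr (Equiv.refl _))

lemma glue_apply {n : ℕ} {α β : Type*} (e : Fin n ≃ α ⊕ β) (p : (α → Fin 2) × (β → Fin 2))
    (l : Fin n) : glue e p l = Sum.elim p.1 p.2 (e l) := rfl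

/-- Vectors of a quantum code have the same reduced state on every set of at most `d - 1`
qubits. -/
lemma exists_reduced_state {n k d : ℕ} {C : Submodule ℂ ((Fin n → Fin 2) → ℂ)}
    (hC : IsQuantumCode n k d C) {α β : Type*} [Fintype α] [Fintype β]
    [DecidableEq α] [DecidableEq β]
    (e : Fin n ≃ α ⊕ β) (hα : Fintype.card α ≤ d - 1) :
    ∃ P : Matrix (α → Fin 2) (α → Fin 2) ℂ, ∀ φ ∈ C, ∀ ψ ∈ C, ∀ x x',
      ∑ w, φ (glue e (x, w)) * star (ψ (glue e (x', w))) = P x x' * (star ψ ⬝ᵥ φ) := by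
  let A : Finset (Fin n) := univ.map (Function.Embedding.inl.trans e.symm.toEmbedding)
  have hA : ∀ i : α, e.symm (.inl i) ∈ A := fun i => by simp [A]
  have hmem : ∀ σ : Fin n → Matrix (Fin 2) (Fin 2) ℂ, (∀ j ∉ A, σ j = 1) →
      tensorPauli σ ∈ detectable C := by
    refine tensorPauli_mem_of_pauli_mem _ A fun σ h1 h2 => ?_
    classical
    have hw : Nat.card {j // σ j ≠ 1} ≤ d - 1 := by
      rw [Nat.card_eq_fintype_card, Fintype.card_subtype]
      refine le_trans (card_le_card fun j hj => ?_)
        ((by simp [A] : A.card ≤ Fintype.card α).trans hα)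
      by_contra hjA
      exact (mem_filter.1 hj).2 (h2 j hjA)
    obtain ⟨r, hr⟩ := hC.2 (tensorPauli σ) ⟨0, σ, by norm_num, h1, hw, by simp⟩
    exact mem_detectable_of_unit hr
  let σ : (α → Fin 2) → (α → Fin 2) → Fin n → Matrix (Fin 2) (Fin 2) ℂ := fun x x' l =>
    Sum.elim (fun i => Matrix.single (x' i) (x i) 1) (fun _ => 1) (e l)
  have hσ : ∀ x x', ∀ j ∉ A, σ x x' j = 1 := by
    intro x x' j hj
    rcases h : e j with i | i
    · exact absurd (hA i) (by rwa [← h, e.symm_apply_apply])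
    · simp [σ, h]
  have hentry : ∀ x x' u v u' v', tensorPauli (σ x x') (glue e (u, v)) (glue e (u', v')) =
      (if x' = u ∧ x = u' then 1 else 0) * (if v = v' then 1 else 0) := by
    intro x x' u v u' v'
    rw [tensorPauli, Matrix.of_apply, ← e.symm.prod_comp, Fintype.prod_sum_type]
    congr 1
    · simp only [glue_apply, σ, Equiv.apply_symm_apply, Sum.elim_inl, Matrix.single_apply]
      rw [Finset.prod_ite_zero]
      simp [funext_iff, forall_and]
    · simp only [glue_apply, σ, Equiv.apply_symm_apply, Sum.elim_inr, Matrix.one_apply]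
      rw [Finset.prod_ite_zero]
      simp [funext_iff]
  choose P hP using fun x x' => hmem (σ x x') (hσ x x')
  refine ⟨P, fun φ hφ ψ hψ x x' => ?_⟩
  rw [← hP x x' φ hφ ψ hψ]
  simp only [dotProduct, mulVec]
  rw [← (glue e).sum_comp, Fintype.sum_prod_type]
  have inner : ∀ u v, ∑ t, tensorPauli (σ x x') (glue e (u, v)) t * φ t =
      if x' = u then φ (glue e (x, v)) else 0 := by
    intro u v
    rw [← (glue e).sum_comp, Fintype.sum_prod_type]
    simp only [hentry]
    by_cases h : x' = u <;> simp [h, ite_mul]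
  simp only [inner]
  rw [Finset.sum_comm]
  simp [mul_comm]

lemma exists_orthonormal_family {m : Type*} [Fintype m] (C : Submodule ℂ (m → ℂ)) :
    ∃ ψ : Fin (Module.finrank ℂ C) → m → ℂ, (∀ i, ψ i ∈ C) ∧
      ∀ i j, star (ψ j) ⬝ᵥ ψ i = if i = j then 1 else 0 := by
  let L := (WithLp.linearEquiv 2 ℂ (m → ℂ)).symm
  let D : Submodule ℂ (EuclideanSpace ℂ m) := C.map (L : (m → ℂ) →ₗ[ℂ] EuclideanSpace ℂ m)
  have hD : Module.finrank ℂ D = Module.finrank ℂ C := L.finrank_map_eq C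
  let b := (stdOrthonormalBasis ℂ D).reindex (finCongr hD)
  refine ⟨fun i => WithLp.ofLp (b i : EuclideanSpace ℂ m), fun i => ?_, fun i j => ?_⟩
  · obtain ⟨v, hv, hvb⟩ := (b i).2
    change WithLp.ofLp (b i : EuclideanSpace ℂ m) ∈ C
    rw [← hvb]
    exact hv
  · have h := orthonormal_iff_ite.1 b.orthonormal j i
    rw [Submodule.coe_inner, EuclideanSpace.inner_eq_star_dotProduct, dotProduct_comm] at h
    rw [h]
    simp [eq_comm]

/-- The code dimension is bounded by the dimension of the qubits outside two disjoint sets of at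
most `d - 1` qubits. -/
lemma le_of_partition {n k d p q r : ℕ} {C : Submodule ℂ ((Fin n → Fin 2) → ℂ)}
    (hC : IsQuantumCode n k d C) (hn : n = p + (q + r)) (hp : p ≤ d - 1) (hq : q ≤ d - 1) :
    k ≤ r := by
  let e : Fin n ≃ Fin p ⊕ (Fin q ⊕ Fin r) :=
    (finCongr hn).trans (finSumFinEquiv.symm.trans
      ((Equiv.refl _).sumCongr finSumFinEquiv.symm))
  let e' : Fin n ≃ Fin q ⊕ (Fin p ⊕ Fin r) :=
    e.trans ((Equiv.sumAssoc _ _ _).symm.trans (((Equiv.sumComm _ _).sumCongr (Equiv.refl _)).trans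
      (Equiv.sumAssoc _ _ _)))
  obtain ⟨ψ, hψ, hon⟩ := exists_orthonormal_family C
  obtain ⟨P, hP⟩ := exists_reduced_state hC e (by simpa using hp)
  obtain ⟨Q, hQ⟩ := exists_reduced_state hC e' (by simpa using hq)
  have hsplit : ∀ (s : ℕ) (f : (Fin s ⊕ Fin r → Fin 2) → ℂ),
      ∑ w, f w = ∑ y : Fin s → Fin 2, ∑ z : Fin r → Fin 2, f (Sum.elim y z) := by
    intro s f
    rw [← (Equiv.sumArrowEquivProdArrow (Fin s) (Fin r) (Fin 2)).symm.sum_comp,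
      Fintype.sum_prod_type]
    rfl
  have hglue : ∀ (x : Fin p → Fin 2) (y : Fin q → Fin 2) (z : Fin r → Fin 2),
      glue e' (y, Sum.elim x z) = glue e (x, Sum.elim y z) := by
    intro x y z
    ext l
    simp only [glue_apply, e', Equiv.trans_apply]
    rcases e l with i | i | i <;> rfl
  have hcard : Fintype.card (Fin (Module.finrank ℂ C)) ≤ Fintype.card (Fin r → Fin 2) := by
    refine card_le_card_of_reduced_states (fun i x y z => ψ i (glue e (x, Sum.elim y z)))
      (P := P) (Q := Q) ?_ (fun i j x x' => ?_) (fun i j y y' => ?_)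
    · rintro rfl
      have hpos : 0 < Module.finrank ℂ C := by rw [hC.1]; positivity
      let i : Fin (Module.finrank ℂ C) := ⟨0, hpos⟩
      have h := hon i i
      rw [dotProduct_comm, dotProduct, ← (glue e).sum_comp, Fintype.sum_prod_type] at h
      have h0 := fun x => hP (ψ i) (hψ i) (ψ i) (hψ i) x x
      simp only [Matrix.zero_apply, zero_mul] at h0
      simp only [Pi.star_apply, h0, sum_const_zero, if_true] at h
      exact zero_ne_one h
    · have h := hP (ψ i) (hψ i) (ψ j) (hψ j) x x'
      rw [hsplit, hon, mul_ite, mul_one, mul_zero] at h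
      exact h
    · have h := hQ (ψ i) (hψ i) (ψ j) (hψ j) y y'
      rw [hsplit, hon, mul_ite, mul_one, mul_zero] at h
      simp only [hglue] at h
      exact h
  rw [Fintype.card_fin, hC.1, Fintype.card_fun, Fintype.card_fin, Fintype.card_fin] at hcard
  exact (Nat.pow_le_pow_iff_right (by norm_num)).1 hcard

/-- **Quantum Singleton (Knill–Laflamme) bound.**  If `C` is an `[[n,k,d]]` quantum code
with `k ≥ 1` and `d ≥ 1`, then `n − k ≥ 2d − 2`. -/
theorem quantum_singleton_bound (n k d : ℕ) (hk : 1 ≤ k) (hd : 1 ≤ d)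
    (C : Submodule ℂ ((Fin n → Fin 2) → ℂ)) (hC : IsQuantumCode n k d C) :
    (2 * d : ℤ) - 2 ≤ (n : ℤ) - k := by
  have h := le_of_partition (p := min (d - 1) n) (q := min (d - 1) (n - min (d - 1) n))
    (r := n - 2 * (d - 1)) hC (by omega) (by omega) (by omega)
  omega

end
end

section
/- Stabilizer code theorem: Let S be an abelian subgroup of the n-qubit Pauli group 𝒫ₙ with −1 ∉ S and |S| = 2^a (where a ≤ n). Let d be the minimum weight of an element P ∈ N(S) such that P is not of the form i^c · M with M ∈ S and c ∈ {0,1,2,3}. Then: (1) the code space T(S) has dimension 2^{n−a}; and (2) for every n-qubit Pauli operator E of weight at most d−1 there is a scalar c(E) ∈ ℂ with ⟪ψ, E ψ⟫ = c(E) for every unit vector ψ ∈ T(S). That is, T(S) is an [[n, n−a, d]] quantum code. -/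
open Matrix Finset

noncomputable section

theorem tensorPauli_mul {n : ℕ} (σ τ : Fin n → Matrix (Fin 2) (Fin 2) ℂ) :
    tensorPauli σ * tensorPauli τ = tensorPauli (fun j => σ j * τ j) := by
  ext x y
  simp only [tensorPauli, Matrix.mul_apply, Matrix.of_apply, ← Finset.prod_mul_distrib]
  rw [Fintype.prod_sum]

theorem tensorPauli_one {n : ℕ} :
    tensorPauli (fun _ : Fin n => (1 : Matrix (Fin 2) (Fin 2) ℂ)) = 1 := by
  ext x y
  simp only [tensorPauli, Matrix.of_apply, Matrix.one_apply, Finset.prod_ite_zero,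
    Finset.prod_const_one, Finset.mem_univ, true_implies, funext_iff]

theorem tensorPauli_smul {n : ℕ} (c : Fin n → ℂ) (σ : Fin n → Matrix (Fin 2) (Fin 2) ℂ) :
    tensorPauli (fun j => c j • σ j) = (∏ j, c j) • tensorPauli σ := by
  ext x y
  simp [tensorPauli, Finset.prod_mul_distrib]

theorem tensorPauli_conjTranspose {n : ℕ} (σ : Fin n → Matrix (Fin 2) (Fin 2) ℂ) :
    (tensorPauli σ)ᴴ = tensorPauli (fun j => (σ j)ᴴ) := by
  ext x y
  simp [tensorPauli, Matrix.conjTranspose_apply]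

theorem trace_tensorPauli {n : ℕ} (σ : Fin n → Matrix (Fin 2) (Fin 2) ℂ) :
    (tensorPauli σ).trace = ∏ j, (σ j).trace := by
  simp only [tensorPauli, Matrix.trace, Matrix.diag_apply, Matrix.of_apply]
  rw [Fintype.prod_sum]

namespace IsSinglePauli

variable {σ τ : Matrix (Fin 2) (Fin 2) ℂ}

theorem mul_self (h : IsSinglePauli σ) : σ * σ = 1 := by
  rcases h with rfl | rfl | rfl | rfl <;> ext i j <;> fin_cases i <;> fin_cases j <;>
    simp [PX, PY, PZ]

theorem conjTranspose_eq (h : IsSinglePauli σ) : σᴴ = σ := by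
  rcases h with rfl | rfl | rfl | rfl <;> ext i j <;> fin_cases i <;> fin_cases j <;>
    simp [PX, PY, PZ]

theorem trace_eq_zero (h : IsSinglePauli σ) (h1 : σ ≠ 1) : σ.trace = 0 := by
  rcases h with rfl | rfl | rfl | rfl
  · exact absurd rfl h1
  all_goals simp [PX, PY, PZ, Matrix.trace]

theorem mul_comm_or_neg (hσ : IsSinglePauli σ) (hτ : IsSinglePauli τ) :
    ∃ ε : ℂ, (ε = 1 ∨ ε = -1) ∧ σ * τ = ε • (τ * σ) := by
  rcases hσ with rfl | rfl | rfl | rfl <;> rcases hτ with rfl | rfl | rfl | rfl <;>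
    first
    | (refine ⟨1, Or.inl rfl, ?_⟩; simp; done)
    | (refine ⟨-1, Or.inr rfl, ?_⟩
       ext i j; fin_cases i <;> fin_cases j <;> simp [PX, PY, PZ])

end IsSinglePauli

theorem tensorPauli_mul_self {n : ℕ} {σ : Fin n → Matrix (Fin 2) (Fin 2) ℂ}
    (h : ∀ j, IsSinglePauli (σ j)) : tensorPauli σ * tensorPauli σ = 1 := by
  simp only [tensorPauli_mul, (h _).mul_self, tensorPauli_one]

namespace IsPauli

variable {n : ℕ} {P Q : MatN n}

theorem conjTranspose_mul_self (h : IsPauli n P) : Pᴴ * P = 1 := by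
  obtain ⟨c, σ, -, hσ, rfl⟩ := h
  simp [tensorPauli_conjTranspose, (hσ _).conjTranspose_eq, tensorPauli_mul_self hσ, smul_smul,
    ← mul_pow]

theorem commute_or_anticommute (hP : IsPauli n P) (hQ : IsPauli n Q) :
    P * Q = Q * P ∨ P * Q = -(Q * P) := by
  obtain ⟨c, σ, -, hσ, rfl⟩ := hP
  obtain ⟨e, τ, -, hτ, rfl⟩ := hQ
  choose ε hε h using fun j => (hσ j).mul_comm_or_neg (hτ j)
  have hprod : ∏ j, ε j = 1 ∨ ∏ j, ε j = -1 := by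
    refine Finset.prod_induction ε (fun z => z = 1 ∨ z = -1) ?_ (Or.inl rfl) fun j _ => hε j
    rintro _ _ (rfl | rfl) (rfl | rfl) <;> simp
  have key : tensorPauli σ * tensorPauli τ =
      (∏ j, ε j) • (tensorPauli τ * tensorPauli σ) := by
    rw [tensorPauli_mul, tensorPauli_mul, ← tensorPauli_smul]
    simp only [h]
  rcases hprod with h1 | h1 <;> rw [h1] at key <;>
    simp [key, smul_smul, mul_comm]

/-- A Pauli operator which is not a phase has trace zero. -/
theorem trace_eq_zero_or (h : IsPauli n P) : P.trace = 0 ∨ ∃ c < 4, P = Complex.I ^ c • 1 := by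
  obtain ⟨c, σ, hc, hσ, rfl⟩ := h
  by_cases h1 : ∀ j, σ j = 1
  · refine Or.inr ⟨c, hc, ?_⟩
    rw [funext h1, tensorPauli_one]
  · push Not at h1
    obtain ⟨j, hj⟩ := h1
    left
    rw [Matrix.trace_smul, trace_tensorPauli,
      Finset.prod_eq_zero (Finset.mem_univ j) ((hσ j).trace_eq_zero hj), smul_zero]

/-- The only Pauli operators of weight zero are the phases. -/
theorem eq_smul_one_of_weight_eq_zero (h : IsPauli n P) (hw : pauliWeight P = 0) :
    ∃ c : ℕ, P = Complex.I ^ c • 1 := by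
  obtain ⟨c, σ, hc, hσ, hP⟩ := h
  have hmem := Nat.sInf_mem (s := {w | ∃ (c : ℕ) (σ : Fin n → Matrix (Fin 2) (Fin 2) ℂ),
    c < 4 ∧ (∀ j, IsSinglePauli (σ j)) ∧ Nat.card {j // σ j ≠ 1} = w ∧
      P = Complex.I ^ c • tensorPauli σ}) ⟨_, c, σ, hc, hσ, rfl, hP⟩
  change pauliWeight P ∈ _ at hmem
  rw [hw] at hmem
  obtain ⟨c, σ, -, -, hcard, rfl⟩ := hmem
  have h1 : ∀ j, σ j = 1 := by
    rw [Finite.card_eq_zero_iff] at hcard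
    intro j
    by_contra hj
    exact hcard.elim ⟨j, hj⟩
  exact ⟨c, by rw [funext h1, tensorPauli_one]⟩

end IsPauli

theorem IsPauliOfWeightLE.isPauli {n w : ℕ} {P : MatN n} (h : IsPauliOfWeightLE n w P) :
    IsPauli n P := by
  obtain ⟨c, σ, hc, hσ, -, hP⟩ := h
  exact ⟨c, σ, hc, hσ, hP⟩

theorem IsPauliOfWeightLE.pauliWeight_le {n w : ℕ} {P : MatN n} (h : IsPauliOfWeightLE n w P) :
    pauliWeight P ≤ w := by
  obtain ⟨c, σ, hc, hσ, hw, hP⟩ := h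
  refine le_trans ?_ hw
  exact Nat.sInf_le ⟨c, σ, hc, hσ, rfl, hP⟩

/-- In a group of Pauli operators not containing `-1`, all elements but `1` have trace zero. -/
theorem trace_eq_zero_of_ne_one {n : ℕ} {S : Subgroup (MatN n)ˣ}
    (hPauli : ∀ P ∈ S, IsPauli n (P : MatN n)) (hneg : (-1 : (MatN n)ˣ) ∉ S)
    {P : (MatN n)ˣ} (hP : P ∈ S) (h1 : P ≠ 1) : (P : MatN n).trace = 0 := by
  refine (hPauli P hP).trace_eq_zero_or.resolve_right ?_
  rintro ⟨c, hc, h⟩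
  have hsq : P * P ≠ -1 := fun h' => hneg (h' ▸ S.mul_mem hP hP)
  interval_cases c
  · exact h1 (Units.ext (by simpa using h))
  · exact hsq (Units.ext (by simp [h, smul_smul]))
  · refine hneg ?_
    convert hP
    exact Units.ext (by simp [h])
  · exact hsq (Units.ext (by simp [h, smul_smul, pow_three]))

/-- The representation of a group of invertible matrices on column vectors. -/
def columnRep {n : ℕ} (S : Subgroup (MatN n)ˣ) :
    Representation ℂ S ((Fin n → Fin 2) → ℂ) :=
  ((Matrix.toLinAlgEquiv' : MatN n ≃ₐ[ℂ] _) : MatN n →* _).comp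
    ((Units.coeHom (MatN n)).comp S.subtype)

theorem columnRep_apply {n : ℕ} (S : Subgroup (MatN n)ˣ) (g : S) :
    columnRep S g = Matrix.toLin' ((g : (MatN n)ˣ) : MatN n) := rfl

theorem invariants_columnRep {n : ℕ} (S : Subgroup (MatN n)ˣ) :
    (columnRep S).invariants = codeSpace (Units.val '' (S : Set (MatN n)ˣ)) := by
  ext ψ
  simp [Representation.mem_invariants, columnRep_apply, codeSpace]

theorem card_mul_finrank_codeSpace {n : ℕ} {S : Subgroup (MatN n)ˣ} [Finite S]
    (hPauli : ∀ P ∈ S, IsPauli n (P : MatN n)) (hneg : (-1 : (MatN n)ˣ) ∉ S) :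
    Nat.card S * Module.finrank ℂ (codeSpace (Units.val '' (S : Set (MatN n)ˣ))) = 2 ^ n := by
  have := Fintype.ofFinite S
  have hS : (Fintype.card S : ℂ) ≠ 0 := Nat.cast_ne_zero.mpr Fintype.card_ne_zero
  have : Invertible (Fintype.card S : ℂ) := invertibleOfNonzero hS
  have htr : LinearMap.trace ℂ _ (columnRep S).averageMap = (Fintype.card S : ℂ)⁻¹ * 2 ^ n := by
    have hsum : ∑ g : S, ((g : (MatN n)ˣ) : MatN n).trace = 2 ^ n := by
      rw [Finset.sum_eq_single 1]
      · simp
      · intro g _ hg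
        exact trace_eq_zero_of_ne_one hPauli hneg g.2 (by simpa using hg)
      · simp
    simp [Representation.averageMap, GroupAlgebra.average, columnRep_apply, hsum]
  rw [(columnRep S).isProj_averageMap.trace, invariants_columnRep,
    eq_inv_mul_iff_mul_eq₀ hS] at htr
  rw [Nat.card_eq_fintype_card]
  exact_mod_cast htr

/-- An operator anticommuting with a unitary that fixes `ψ` has zero expectation in `ψ`. -/
theorem dotProduct_mulVec_eq_zero_of_anticommute {ι : Type*} [Fintype ι] [DecidableEq ι]
    {E Q : Matrix ι ι ℂ} {ψ : ι → ℂ} (hQ : Qᴴ * Q = 1) (hψ : Q *ᵥ ψ = ψ)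
    (h : E * Q = -(Q * E)) : star ψ ⬝ᵥ E *ᵥ ψ = 0 := by
  have hψ' : Qᴴ *ᵥ ψ = ψ := by
    nth_rewrite 1 [← hψ]
    rw [Matrix.mulVec_mulVec, hQ, Matrix.one_mulVec]
  have hstar : star ψ ᵥ* Q = star ψ := by
    simpa [Matrix.star_mulVec] using congrArg star hψ'
  have key : star ψ ⬝ᵥ E *ᵥ ψ = -(star ψ ⬝ᵥ E *ᵥ ψ) := by
    conv_lhs => rw [← hψ, Matrix.mulVec_mulVec, hψ, h, Matrix.neg_mulVec, dotProduct_neg,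
      ← Matrix.mulVec_mulVec, Matrix.dotProduct_mulVec, hstar]
  exact self_eq_neg.mp key

/-- **Stabilizer code theorem.**  Let `S` be an abelian subgroup of the `n`-qubit Pauli
group with `−1 ∉ S` and `|S| = 2^a` (`a ≤ n`), and let `d` be the minimum weight of a
Pauli operator commuting with all of `S` but not equal to a phase `i^c` times an element
of `S`.  Then the code space `T(S)` has dimension `2^{n−a}`, and every Pauli error of
weight at most `d−1` has constant expectation on unit codewords; that is, `T(S)` is an
`[[n, n−a, d]]` quantum code. -/
theorem stabilizer_code (n a d : ℕ) (ha : a ≤ n)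
    (S : Subgroup (MatN n)ˣ)
    (hPauli : ∀ P ∈ S, IsPauli n (P : MatN n))
    (hab : ∀ P ∈ S, ∀ Q ∈ S, P * Q = Q * P)
    (hneg : (-1 : (MatN n)ˣ) ∉ S)
    (hcard : Nat.card S = 2 ^ a)
    (hd : IsLeast {w : ℕ | ∃ P : (MatN n)ˣ, IsPauli n (P : MatN n) ∧
        (∀ Q ∈ S, P * Q = Q * P) ∧
        (¬ ∃ (c : ℕ) (Q : (MatN n)ˣ), Q ∈ S ∧
            (P : MatN n) = Complex.I ^ c • (Q : MatN n)) ∧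
        pauliWeight (P : MatN n) = w} d) :
    Module.finrank ℂ (codeSpace (Units.val '' (S : Set (MatN n)ˣ))) = 2 ^ (n - a) ∧
    ∀ E : MatN n, IsPauliOfWeightLE n (d - 1) E →
      ∃ cE : ℂ, ∀ ψ ∈ codeSpace (Units.val '' (S : Set (MatN n)ˣ)),
        star ψ ⬝ᵥ ψ = 1 → star ψ ⬝ᵥ E.mulVec ψ = cE := by
  have hS : Finite S := Nat.finite_of_card_ne_zero (by rw [hcard]; positivity)
  refine ⟨?_, fun E hE => ?_⟩
  · have h := card_mul_finrank_codeSpace hPauli hneg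
    rw [hcard, ← pow_mul_pow_sub 2 ha] at h
    exact Nat.eq_of_mul_eq_mul_left (by positivity) h
  by_cases hcomm : ∀ Q ∈ S, E * (Q : MatN n) = Q * E
  · have hphase : ∃ (c : ℕ) (Q : (MatN n)ˣ), Q ∈ S ∧ E = Complex.I ^ c • (Q : MatN n) := by
      by_contra hnot
      have hunit := hE.isPauli.conjTranspose_mul_self
      let P : (MatN n)ˣ := ⟨E, Eᴴ, mul_eq_one_comm.mp hunit, hunit⟩
      have hle : d ≤ d - 1 := (hd.2 ⟨P, hE.isPauli,
        fun Q hQ => Units.ext (hcomm Q hQ), hnot, rfl⟩).trans hE.pauliWeight_le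
      obtain ⟨R, hR, -, hRnot, hRw⟩ := hd.1
      obtain ⟨c, hc⟩ := hR.eq_smul_one_of_weight_eq_zero (by omega)
      exact hRnot ⟨c, 1, S.one_mem, by simpa using hc⟩
    obtain ⟨c, Q, hQ, rfl⟩ := hphase
    refine ⟨Complex.I ^ c, fun ψ hψ hnorm => ?_⟩
    rw [Matrix.smul_mulVec, hψ _ ⟨Q, hQ, rfl⟩, dotProduct_smul, hnorm, smul_eq_mul, mul_one]
  · push Not at hcomm
    obtain ⟨Q, hQ, hne⟩ := hcomm
    exact ⟨0, fun ψ hψ _ => dotProduct_mulVec_eq_zero_of_anticommute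
      (hPauli Q hQ).conjTranspose_mul_self (hψ _ ⟨Q, hQ, rfl⟩)
      ((hE.isPauli.commute_or_anticommute (hPauli Q hQ)).resolve_left hne)⟩

end
end
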